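/- PageRank for a basic absorbing graph: π^T e_I ≤ π_0^T e_I, with equality if and only if E_out(I) = ∅. That is, the PageRank of I in the original graph never exceeds the PageRank of I in the basic absorbing graph, and they coincide exactly when I has no external outlinks. -/

import Mathlib

open Matrix Finset

/-- Outdegree of node `i` in the edge set `E`. -/
def outdeg {n : ℕ} (E : Finset (Fin n × Fin n)) (i : Fin n) : ℕ :=
  (Finset.univ.filter (fun j => (i, j) ∈ E)).card

/-- The scaled adjacency matrix `P` of the graph: `P i j = 1 / outdeg i` if `(i,j) ∈ E`. -/
noncomputable def Pmat {n : ℕ} (E : Finset (Fin n × Fin n)) : Matrix (Fin n) (Fin n) ℝ :=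
  fun i j => if (i, j) ∈ E then ((outdeg E i : ℝ))⁻¹ else 0

/-- Indicator vector of a set of nodes. -/
def ind {n : ℕ} (I : Finset (Fin n)) : Fin n → ℝ :=
  fun i => if i ∈ I then 1 else 0

/-- `v = (Id - cP)⁻¹ e_I`, the vector of mean numbers of visits to `I` before zapping. -/
noncomputable def vvec {n : ℕ} (c : ℝ) (E : Finset (Fin n × Fin n)) (I : Finset (Fin n)) : Fin n → ℝ :=
  (1 - c • Pmat E)⁻¹ *ᵥ ind I

/-- PageRank vector `πᵀ = (1-c) zᵀ (Id - cP)⁻¹`. -/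
noncomputable def pr {n : ℕ} (c : ℝ) (z : Fin n → ℝ) (E : Finset (Fin n × Fin n)) : Fin n → ℝ :=
  (1 - c) • (((1 - c • Pmat E)⁻¹)ᵀ *ᵥ z)

/-- PageRank of the set `I`: `πᵀ e_I`. -/
noncomputable def prSet {n : ℕ} (c : ℝ) (z : Fin n → ℝ) (E : Finset (Fin n × Fin n))
    (I : Finset (Fin n)) : ℝ :=
  ∑ i ∈ I, pr c z E i

/-- Node `i` has access to (some node of) the set `J`: `i ∈ J` or a directed path from `i`
reaches `J`. -/
def access {n : ℕ} (E : Finset (Fin n × Fin n)) (i : Fin n) (J : Finset (Fin n)) : Prop :=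
  ∃ j ∈ J, Relation.ReflTransGen (fun a b => (a, b) ∈ E) i j

lemma Pmat_nonneg' {n : ℕ} (E : Finset (Fin n × Fin n)) (i j : Fin n) : 0 ≤ Pmat E i j := by
  unfold Pmat; split_ifs <;> positivity

lemma Pmat_row {n : ℕ} (E : Finset (Fin n × Fin n)) (hE : ∀ i, 0 < outdeg E i) (i : Fin n) :
    ∑ j, Pmat E i j = 1 := by
  have h : (outdeg E i : ℝ) ≠ 0 := by exact_mod_cast (hE i).ne'
  unfold Pmat
  rw [← Finset.sum_filter, Finset.sum_const, nsmul_eq_mul]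
  exact mul_inv_cancel₀ h

lemma min_principle {n : ℕ} (E : Finset (Fin n × Fin n)) (hE : ∀ i, 0 < outdeg E i)
    (c : ℝ) (hc0 : 0 < c) (hc1 : c < 1) (x : Fin n → ℝ)
    (hx : ∀ i, c * ∑ j, Pmat E i j * x j ≤ x i) (i : Fin n) : 0 ≤ x i := by
  obtain ⟨m, -, hm⟩ := Finset.exists_min_image Finset.univ x ⟨i, Finset.mem_univ i⟩
  have h1 : x m ≤ ∑ j, Pmat E m j * x j := by
    calc x m = ∑ j, Pmat E m j * x m := by rw [← Finset.sum_mul, Pmat_row E hE, one_mul]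
      _ ≤ _ := Finset.sum_le_sum fun j hj =>
        mul_le_mul_of_nonneg_left (hm j hj) (Pmat_nonneg' E m j)
  have h2 := hx m
  have h3 := hm i (Finset.mem_univ i)
  nlinarith

lemma mulVec_apply' {n : ℕ} (E : Finset (Fin n × Fin n)) (c : ℝ) (x : Fin n → ℝ) (i : Fin n) :
    ((1 - c • Pmat E) *ᵥ x) i = x i - c * ∑ j, Pmat E i j * x j := by
  rw [Matrix.sub_mulVec, Matrix.one_mulVec, Matrix.smul_mulVec]
  simp [Matrix.mulVec, dotProduct]

lemma det_unit {n : ℕ} (E : Finset (Fin n × Fin n)) (hE : ∀ i, 0 < outdeg E i)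
    (c : ℝ) (hc0 : 0 < c) (hc1 : c < 1) : IsUnit (1 - c • Pmat E).det := by
  rw [isUnit_iff_ne_zero]
  intro h
  obtain ⟨x, hx0, hx⟩ := Matrix.exists_mulVec_eq_zero_iff.mpr h
  apply hx0
  have key : ∀ i, x i = c * ∑ j, Pmat E i j * x j := fun i => by
    have := mulVec_apply' E c x i
    rw [hx] at this
    simp only [Pi.zero_apply] at this
    linarith
  funext i
  have h1 := min_principle E hE c hc0 hc1 x (fun i => (key i).ge) i
  have h2 := min_principle E hE c hc0 hc1 (fun i => - x i) (fun i => by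
    simp only [mul_neg, Finset.sum_neg_distrib]
    linarith [key i]) i
  simp only [Pi.zero_apply]
  linarith

lemma vvec_eq {n : ℕ} (E : Finset (Fin n × Fin n)) (hE : ∀ i, 0 < outdeg E i)
    (c : ℝ) (hc0 : 0 < c) (hc1 : c < 1) (I : Finset (Fin n)) (i : Fin n) :
    vvec c E I i = ind I i + c * ∑ j, Pmat E i j * vvec c E I j := by
  have h : (1 - c • Pmat E) *ᵥ vvec c E I = ind I := by
    unfold vvec
    rw [Matrix.mulVec_mulVec, Matrix.mul_nonsing_inv _ (det_unit E hE c hc0 hc1),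
      Matrix.one_mulVec]
  have := mulVec_apply' E c (vvec c E I) i
  rw [h] at this
  linarith

lemma prSet_eq {n : ℕ} (c : ℝ) (z : Fin n → ℝ) (E : Finset (Fin n × Fin n))
    (I : Finset (Fin n)) : prSet c z E I = (1 - c) * ∑ i, z i * vvec c E I i := by
  have h : prSet c z E I = pr c z E ⬝ᵥ ind I := by
    simp [prSet, dotProduct, ind]
  rw [h, pr, smul_dotProduct, Matrix.mulVec_transpose, ← Matrix.dotProduct_mulVec]
  rfl

lemma sum_le_of_le {n : ℕ} (E : Finset (Fin n × Fin n)) (hE : ∀ i, 0 < outdeg E i)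
    (x : Fin n → ℝ) (b : ℝ) (hx : ∀ i, x i ≤ b) (i : Fin n) :
    ∑ j, Pmat E i j * x j ≤ b := by
  calc _ ≤ ∑ j, Pmat E i j * b := Finset.sum_le_sum fun j _ =>
        mul_le_mul_of_nonneg_left (hx j) (Pmat_nonneg' E i j)
    _ = b := by rw [← Finset.sum_mul, Pmat_row E hE, one_mul]

lemma vvec_le {n : ℕ} (E : Finset (Fin n × Fin n)) (hE : ∀ i, 0 < outdeg E i)
    (c : ℝ) (hc0 : 0 < c) (hc1 : c < 1) (I : Finset (Fin n)) (i : Fin n) :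
    vvec c E I i ≤ (1 - c)⁻¹ := by
  have hb : (1 - c)⁻¹ * (1 - c) = 1 := inv_mul_cancel₀ (by linarith)
  have h := min_principle E hE c hc0 hc1 (fun i => (1 - c)⁻¹ - vvec c E I i) (fun i => by
    simp only [mul_sub, Finset.sum_sub_distrib, ← Finset.sum_mul, Pmat_row E hE]
    have h1 := vvec_eq E hE c hc0 hc1 I i
    have h2 : ind I i ≤ 1 := by unfold ind; split_ifs <;> norm_num
    linarith) i
  linarith

lemma E0_row_in {n : ℕ} (E : Finset (Fin n × Fin n)) (I : Finset (Fin n)) (i : Fin n)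
    (hi : i ∈ I) (j : Fin n) :
    (i, j) ∈ (I.image (fun i => (i, i)) ∪ E.filter (fun p => p.1 ∉ I)) ↔ i = j := by
  simp only [Finset.mem_union, Finset.mem_image, Prod.mk.injEq, Finset.mem_filter]
  constructor
  · rintro (⟨a, _, rfl, h⟩ | ⟨_, h⟩)
    · exact h
    · exact absurd hi h
  · rintro rfl
    exact Or.inl ⟨i, hi, rfl, rfl⟩

lemma E0_row_out {n : ℕ} (E : Finset (Fin n × Fin n)) (I : Finset (Fin n)) (i : Fin n)
    (hi : i ∉ I) (j : Fin n) :
    (i, j) ∈ (I.image (fun i => (i, i)) ∪ E.filter (fun p => p.1 ∉ I)) ↔ (i, j) ∈ E := by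
  simp only [Finset.mem_union, Finset.mem_image, Prod.mk.injEq, Finset.mem_filter]
  constructor
  · rintro (⟨a, h, rfl, _⟩ | ⟨h, _⟩)
    · exact absurd h hi
    · exact h
  · intro h
    exact Or.inr ⟨h, hi⟩

/-- Proposition 8 (PageRank for a basic absorbing graph): the PageRank of `I` never
exceeds its PageRank in the basic absorbing graph
`E⁰ = {(i,i) : i ∈ I} ∪ E_in(I) ∪ E_Ī`, with equality iff `E_out(I) = ∅`. -/
theorem stmt9 {n : ℕ} (hn : 1 ≤ n) (E : Finset (Fin n × Fin n))
    (hE : ∀ i, 0 < outdeg E i) (c : ℝ) (hc0 : 0 < c) (hc1 : c < 1)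
    (z : Fin n → ℝ) (hz : ∀ i, 0 < z i) (hz1 : ∑ i, z i = 1)
    (I : Finset (Fin n)) :
    prSet c z E I ≤
      prSet c z (I.image (fun i => (i, i)) ∪ E.filter (fun p => p.1 ∉ I)) I ∧
    (prSet c z E I =
        prSet c z (I.image (fun i => (i, i)) ∪ E.filter (fun p => p.1 ∉ I)) I ↔
      E.filter (fun p => p.1 ∈ I ∧ p.2 ∉ I) = ∅) := by
  set E0 := (I.image (fun i => (i, i)) ∪ E.filter (fun p => p.1 ∉ I)) with hE0def
  have d1 : ∀ i ∈ I, outdeg E0 i = 1 := fun i hi => by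
    unfold outdeg
    have hm : ∀ j, (i, j) ∈ E0 ↔ i = j := E0_row_in E I i hi
    simp only [hm]
    rw [Finset.filter_eq, if_pos (Finset.mem_univ i), Finset.card_singleton]
  have d2 : ∀ i ∉ I, outdeg E0 i = outdeg E i := fun i hi => by
    unfold outdeg
    have hm : ∀ j, (i, j) ∈ E0 ↔ (i, j) ∈ E := E0_row_out E I i hi
    simp only [hm]
  have P1 : ∀ i ∈ I, ∀ x : Fin n → ℝ, ∑ j, Pmat E0 i j * x j = x i := fun i hi x => by
    unfold Pmat
    have hm : ∀ j, (i, j) ∈ E0 ↔ i = j := E0_row_in E I i hi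
    simp [d1 i hi, hm]
  have P2 : ∀ i ∉ I, ∀ j, Pmat E0 i j = Pmat E i j := fun i hi j => by
    unfold Pmat
    have hm : ∀ j, (i, j) ∈ E0 ↔ (i, j) ∈ E := E0_row_out E I i hi
    simp only [d2 i hi, hm]
  have hE0 : ∀ i, 0 < outdeg E0 i := fun i => by
    by_cases hi : i ∈ I
    · rw [d1 i hi]; norm_num
    · rw [d2 i hi]; exact hE i
  have hc : 0 < 1 - c := by linarith
  have hb : (1 - c)⁻¹ * (1 - c) = 1 := inv_mul_cancel₀ hc.ne'
  have hbpos : 0 < (1 - c)⁻¹ := inv_pos.mpr hc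
  have v0I : ∀ i ∈ I, vvec c E0 I i = (1 - c)⁻¹ := fun i hi => by
    have h := vvec_eq E0 hE0 c hc0 hc1 I i
    rw [P1 i hi] at h
    have h2 : ind I i = 1 := by simp [ind, hi]
    rw [h2] at h
    apply mul_right_cancel₀ hc.ne'
    rw [hb]; linarith
  have v0le := vvec_le E0 hE0 c hc0 hc1 I
  have vle := vvec_le E hE c hc0 hc1 I
  have veq := vvec_eq E hE c hc0 hc1 I
  have voutE0 : ∀ i ∉ I, vvec c E0 I i = c * ∑ j, Pmat E i j * vvec c E0 I j := fun i hi => by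
    have h := vvec_eq E0 hE0 c hc0 hc1 I i
    simp only [P2 i hi] at h
    rw [h]
    simp [ind, hi]
  have voutE : ∀ i ∉ I, vvec c E I i = c * ∑ j, Pmat E i j * vvec c E I j := fun i hi => by
    rw [veq i]
    simp [ind, hi]
  have vinE : ∀ i ∈ I, vvec c E I i = 1 + c * ∑ j, Pmat E i j * vvec c E I j := fun i hi => by
    rw [veq i]
    simp [ind, hi]
  have hle : ∀ i, vvec c E I i ≤ vvec c E0 I i := fun i => by
    have h := min_principle E hE c hc0 hc1 (fun i => vvec c E0 I i - vvec c E I i) (fun i => by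
      simp only [mul_sub, Finset.sum_sub_distrib]
      by_cases hi : i ∈ I
      · have h1 := sum_le_of_le E hE _ _ v0le i
        have h2 := vinE i hi
        have h3 := v0I i hi
        nlinarith
      · linarith [voutE i hi, voutE0 i hi]) i
    linarith
  have hsum : ∀ i ∈ Finset.univ, z i * vvec c E I i ≤ z i * vvec c E0 I i := fun i _ =>
    mul_le_mul_of_nonneg_left (hle i) (hz i).le
  rw [prSet_eq, prSet_eq]
  refine ⟨mul_le_mul_of_nonneg_left (Finset.sum_le_sum hsum) hc.le, ?_⟩
  rw [mul_right_inj' hc.ne', Finset.sum_eq_sum_iff_of_le hsum]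
  constructor
  · intro h
    have hv : ∀ i, vvec c E I i = vvec c E0 I i := fun i =>
      mul_left_cancel₀ (hz i).ne' (h i (Finset.mem_univ i))
    rw [Finset.eq_empty_iff_forall_notMem]
    rintro ⟨i, j⟩ hij
    simp only [Finset.mem_filter] at hij
    obtain ⟨hijE, hi, hj⟩ := hij
    have h1 : vvec c E I j < (1 - c)⁻¹ := by
      have h2 := sum_le_of_le E hE _ _ vle j
      have h3 := voutE j hj
      nlinarith
    have hP : 0 < Pmat E i j := by
      unfold Pmat
      rw [if_pos hijE]
      exact inv_pos.mpr (by exact_mod_cast hE i)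
    have h4 : ∑ j, Pmat E i j * vvec c E I j < ∑ j, Pmat E i j * (1 - c)⁻¹ :=
      Finset.sum_lt_sum (fun k _ => mul_le_mul_of_nonneg_left (vle k) (Pmat_nonneg' E i k))
        ⟨j, Finset.mem_univ j, mul_lt_mul_of_pos_left h1 hP⟩
    rw [← Finset.sum_mul, Pmat_row E hE, one_mul] at h4
    have h5 := vinE i hi
    rw [hv i, v0I i hi] at h5
    nlinarith
  · intro h i _
    have hin : ∀ i ∈ I, ∀ j, Pmat E i j * vvec c E0 I j = Pmat E i j * (1 - c)⁻¹ := by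
      intro i hi j
      by_cases hj : j ∈ I
      · rw [v0I j hj]
      · have : (i, j) ∉ E := fun hij => by
          have : (i, j) ∈ E.filter (fun p => p.1 ∈ I ∧ p.2 ∉ I) := by
            simp [hij, hi, hj]
          rw [h] at this
          simp at this
        simp [Pmat, this]
    have h := min_principle E hE c hc0 hc1 (fun i => vvec c E I i - vvec c E0 I i) (fun i => by
      simp only [mul_sub, Finset.sum_sub_distrib]
      by_cases hi : i ∈ I
      · simp only [hin i hi]
        rw [← Finset.sum_mul, Pmat_row E hE, one_mul]
        have h2 := vinE i hi
        have h3 := v0I i hi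
        linarith
      · linarith [voutE i hi, voutE0 i hi]) i
    rw [le_antisymm (hle i) (by linarith)]
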